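/- Main theorem: Let (G,≺) be a POP-graph and let ≺_V be the induced relation on V(G): v1 ≺_V v2 if and only if v1 ≠ v2 and at least one of the following holds: (1) I(v1), I(v2) are nonempty and i⁺(v1) ≺ i⁺(v2); (2) I(v1), O(v2) are nonempty and i⁺(v1) ≺ o⁻(v2); (3) O(v1), I(v2) are nonempty and o⁻(v1) ⪯ i⁺(v2); (4) O(v1), O(v2) are nonempty and o⁻(v1) ≺ o⁻(v2). Then ≺_V is a planar order on the vertex poset (V(G), →): it is a strict linear order on V(G) such that (P1) v1 → v2 implies v1 ≺_V v2, and (P2) v1 ≺_V v2 ≺_V v3 and v1 → v3 imply v1 → v2 or v2 → v3. -/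

import Mathlib

/-- A strict linear order: irreflexive, transitive, and any two distinct
elements are comparable. -/
def IsStrictLinearOrder {X : Type*} (prec : X → X → Prop) : Prop :=
  (∀ x, ¬ prec x x) ∧ (∀ x y z, prec x y → prec y z → prec x z) ∧
    ∀ x y, x ≠ y → prec x y ∨ prec y x

/-- A planar order on `(X, r)`: a strict linear order `prec` satisfying
(P1) `r x y → prec x y` and (P2) `prec x1 x2 → prec x2 x3 → r x1 x3 →
r x1 x2 ∨ r x2 x3`. -/
def IsPlanarOrder {X : Type*} (r prec : X → X → Prop) : Prop :=
  IsStrictLinearOrder prec ∧ (∀ x y, r x y → prec x y) ∧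
    ∀ x1 x2 x3, prec x1 x2 → prec x2 x3 → r x1 x3 → r x1 x2 ∨ r x2 x3

/-- A list of edges is a chain if consecutive edges are head-to-tail:
the target of each edge is the source of the next. -/
def EdgeChain {V E : Type*} (s t : E → V) (p : List E) : Prop :=
  List.Chain' (fun a b => t a = s b) p

/-- Vertex reachability: there is a nonempty directed path of edges starting
at `v` and ending at `w`. -/
def VReach {V E : Type*} (s t : E → V) (v w : V) : Prop :=
  ∃ (e : E) (p : List E), EdgeChain s t (e :: p) ∧ s e = v ∧
    t ((e :: p).getLast (List.cons_ne_nil _ _)) = w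

/-- The edge-poset relation: `e → f` iff `e ≠ f` and there is a directed path
whose first edge is `e` and whose last edge is `f`. -/
def EReach {V E : Type*} (s t : E → V) (e f : E) : Prop :=
  e ≠ f ∧ ∃ p : List E, EdgeChain s t (e :: p) ∧
    (e :: p).getLast (List.cons_ne_nil _ _) = f

/-- The graph is acyclic: no vertex reaches itself. -/
def Acyclic {V E : Type*} (s t : E → V) : Prop :=
  ∀ v, ¬ VReach s t v v

/-- The degree of a vertex: the number of incident edges, counting an edge
once for each incidence. -/
noncomputable def degree {V E : Type*} [Fintype E] (s t : E → V) (v : V) : ℕ :=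
  Nat.card {e : E // s e = v} + Nat.card {e : E // t e = v}

/-- A processive graph: a finite acyclic directed multigraph in which every
source and every sink has exactly one incident edge. -/
def Processive {V E : Type*} [Fintype E] (s t : E → V) : Prop :=
  Acyclic s t ∧
    (∀ v : V, (∀ e, t e ≠ v) → degree s t v = 1) ∧
    (∀ v : V, (∀ e, s e ≠ v) → degree s t v = 1)

/-- `m` is the maximum, with respect to the strict order `prec`, of the set
of elements satisfying `P`. -/
def IsMaxIn {X : Type*} (prec : X → X → Prop) (P : X → Prop) (m : X) : Prop :=
  P m ∧ ∀ x, P x → x = m ∨ prec x m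

/-- `m` is the minimum, with respect to the strict order `prec`, of the set
of elements satisfying `P`. -/
def IsMinIn {X : Type*} (prec : X → X → Prop) (P : X → Prop) (m : X) : Prop :=
  P m ∧ ∀ x, P x → x = m ∨ prec m x

/-- `x ⪯ y`: `x = y` or `x ≺ y`. -/
def WeakPrec {X : Type*} (prec : X → X → Prop) (x y : X) : Prop :=
  x = y ∨ prec x y

/-- The induced relation `≺_V` on vertices: `v1 ≺_V v2` iff `v1 ≠ v2` and
(1) `i⁺(v1) ≺ i⁺(v2)`, or (2) `i⁺(v1) ≺ o⁻(v2)`, or (3) `o⁻(v1) ⪯ i⁺(v2)`,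
or (4) `o⁻(v1) ≺ o⁻(v2)`, whenever the relevant maxima/minima exist. -/
def VPrec {V E : Type*} (s t : E → V) (prec : E → E → Prop) (v1 v2 : V) : Prop :=
  v1 ≠ v2 ∧
    ((∃ i1 i2, IsMaxIn prec (fun e => t e = v1) i1 ∧
        IsMaxIn prec (fun e => t e = v2) i2 ∧ prec i1 i2) ∨
     (∃ i1 o2, IsMaxIn prec (fun e => t e = v1) i1 ∧
        IsMinIn prec (fun e => s e = v2) o2 ∧ prec i1 o2) ∨
     (∃ o1 i2, IsMinIn prec (fun e => s e = v1) o1 ∧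
        IsMaxIn prec (fun e => t e = v2) i2 ∧ WeakPrec prec o1 i2) ∨
     (∃ o1 o2, IsMinIn prec (fun e => s e = v1) o1 ∧
        IsMinIn prec (fun e => s e = v2) o2 ∧ prec o1 o2))

/-- Single-edge adjacency of vertices. -/
def EdgeAdj {V E : Type*} (s t : E → V) (v w : V) : Prop := ∃ e, s e = v ∧ t e = w

open Relation in
theorem chain_to_rtg {V E : Type*} (s t : E → V) (p : List E) : ∀ e : E,
    EdgeChain s t (e :: p) →
    (e = (e :: p).getLast (List.cons_ne_nil _ _) ∨
      ReflTransGen (EdgeAdj s t) (t e) (s ((e :: p).getLast (List.cons_ne_nil _ _)))) := by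
  induction p with
  | nil => intro e _; left; rfl
  | cons f q ih =>
    intro e h
    right
    have h' : t e = s f ∧ EdgeChain s t (f :: q) := by
      unfold EdgeChain at *
      exact List.isChain_cons_cons.mp h
    rw [List.getLast_cons (List.cons_ne_nil _ _), h'.1]
    rcases ih f h'.2 with h1 | h1
    · rw [← h1]
    · exact ReflTransGen.head ⟨f, rfl, rfl⟩ h1

open Relation in
theorem rtg_to_chain {V E : Type*} (s t : E → V) (f : E) (v : V)
    (h : ReflTransGen (EdgeAdj s t) v (s f)) : ∀ e, t e = v →
    ∃ p : List E, EdgeChain s t (e :: p) ∧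
      (e :: p).getLast (List.cons_ne_nil _ _) = f := by
  induction h using ReflTransGen.head_induction_on with
  | refl =>
    intro e he
    refine ⟨[f], ?_, rfl⟩
    unfold EdgeChain
    exact List.isChain_cons_cons.mpr ⟨he, List.isChain_singleton _⟩
  | head h1 _ ih =>
    intro e he
    obtain ⟨g, hg1, hg2⟩ := h1
    obtain ⟨p, hp, hl⟩ := ih g hg2
    refine ⟨g :: p, ?_, ?_⟩
    · unfold EdgeChain at *
      exact List.isChain_cons_cons.mpr ⟨he.trans hg1.symm, hp⟩
    · rw [List.getLast_cons (List.cons_ne_nil _ _)]; exact hl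

open Relation in
theorem vreach_iff {V E : Type*} (s t : E → V) (v w : V) :
    VReach s t v w ↔ TransGen (EdgeAdj s t) v w := by
  constructor
  · rintro ⟨e, p, hc, hs, ht⟩
    rcases chain_to_rtg s t p e hc with h | h
    · rw [← h] at ht
      exact TransGen.single ⟨e, hs, ht⟩
    · exact TransGen.head' ⟨e, hs, rfl⟩ (h.tail ⟨_, rfl, ht⟩)
  · intro h
    obtain ⟨u, ⟨e, he, he'⟩, hr⟩ := TransGen.head'_iff.mp h
    rcases ReflTransGen.cases_tail hr with h1 | ⟨x, hx, f, hf, hf'⟩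
    · refine ⟨e, [], ?_, he, ?_⟩
      · unfold EdgeChain; exact List.isChain_singleton _
      · simp [he', h1]
    · subst hf
      obtain ⟨p, hp, hl⟩ := rtg_to_chain s t f u hx e he'
      exact ⟨e, p, hp, he, by rw [hl]; exact hf'⟩

open Relation in
theorem ereach_iff {V E : Type*} (s t : E → V) (hac : Acyclic s t) (e f : E) :
    EReach s t e f ↔ ReflTransGen (EdgeAdj s t) (t e) (s f) := by
  constructor
  · rintro ⟨hne, p, hp, hl⟩
    rcases chain_to_rtg s t p e hp with h | h
    · exact absurd (h.trans hl) hne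
    · rwa [hl] at h
  · intro h
    refine ⟨?_, rtg_to_chain s t f _ h e rfl⟩
    rintro rfl
    exact hac (s e) ((vreach_iff s t _ _).mpr (TransGen.head' ⟨e, rfl, rfl⟩ h))

theorem degree_sink {V E : Type*} [Fintype E] (s t : E → V) (v : V)
    (hd : degree s t v = 1) (e f : E) (he : t e = v) (hf : t f = v) : e = f := by
  unfold degree at hd
  have hpos : 0 < Nat.card {e : E // t e = v} := by
    haveI : Nonempty {e : E // t e = v} := ⟨⟨e, he⟩⟩
    exact Nat.card_pos
  have h1 : Nat.card {e : E // t e = v} = 1 := by omega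
  have := (Nat.card_eq_one_iff_unique.mp h1).1
  exact congrArg Subtype.val (this.elim ⟨e, he⟩ ⟨f, hf⟩)

theorem degree_source {V E : Type*} [Fintype E] (s t : E → V) (v : V)
    (hd : degree s t v = 1) (e f : E) (he : s e = v) (hf : s f = v) : e = f := by
  unfold degree at hd
  have hpos : 0 < Nat.card {e : E // s e = v} := by
    haveI : Nonempty {e : E // s e = v} := ⟨⟨e, he⟩⟩
    exact Nat.card_pos
  have h1 : Nat.card {e : E // s e = v} = 1 := by omega
  have := (Nat.card_eq_one_iff_unique.mp h1).1
  exact congrArg Subtype.val (this.elim ⟨e, he⟩ ⟨f, hf⟩)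

theorem exists_incident {V E : Type*} [Fintype E] (s t : E → V) (v : V)
    (hd : degree s t v = 1) (h : ∀ e, t e ≠ v) : ∃ e, s e = v := by
  by_contra! hs
  unfold degree at hd
  haveI : IsEmpty {e : E // s e = v} := ⟨fun x => hs x.1 x.2⟩
  haveI : IsEmpty {e : E // t e = v} := ⟨fun x => h x.1 x.2⟩
  simp at hd

/-- A strict linear order on a finite type has a rank function. -/
theorem exists_rank {E : Type*} [Fintype E] (prec : E → E → Prop)
    (hl : IsStrictLinearOrder prec) :
    ∃ ρ : E → ℕ, (∀ e f, prec e f ↔ ρ e < ρ f) ∧ (∀ e f, ρ e = ρ f → e = f) ∧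
      ∀ i o, prec i o → (∀ x, prec i x → prec x o → False) → ρ o = ρ i + 1 := by
  classical
  obtain ⟨irr, tr, tot⟩ := hl
  let ρ : E → ℕ := fun e => (Finset.univ.filter (fun x => prec x e)).card
  have mono : ∀ e f, prec e f → ρ e < ρ f := by
    intro e f h
    apply Finset.card_lt_card
    rw [Finset.ssubset_iff_of_subset]
    · exact ⟨e, by simpa using h, by simpa using irr e⟩
    · intro x hx
      simp at hx ⊢
      exact tr _ _ _ hx h
  have iff : ∀ e f, prec e f ↔ ρ e < ρ f := by
    intro e f
    refine ⟨mono e f, fun h => ?_⟩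
    by_cases hef : e = f
    · subst hef; omega
    · rcases tot e f hef with h1 | h1
      · exact h1
      · have := mono _ _ h1; omega
  refine ⟨ρ, iff, ?_, ?_⟩
  · intro e f h
    by_contra hef
    rcases tot e f hef with h1 | h1 <;> have := mono _ _ h1 <;> omega
  · intro i o hio hb
    have : (Finset.univ.filter (fun x => prec x o)) =
        insert i (Finset.univ.filter (fun x => prec x i)) := by
      ext x
      simp
      constructor
      · intro hx
        by_cases hxi : x = i
        · exact Or.inl hxi
        · rcases tot x i hxi with h1 | h1
          · exact Or.inr h1
          · exact (hb x h1 hx).elim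
      · rintro (rfl | h)
        · exact hio
        · exact tr _ _ _ h hio
    show (Finset.univ.filter (fun x => prec x o)).card = _
    rw [this, Finset.card_insert_of_notMem (by simpa using irr i)]

theorem exists_maxIn {E : Type*} [Fintype E] (prec : E → E → Prop) (ρ : E → ℕ)
    (h1 : ∀ e f, prec e f ↔ ρ e < ρ f) (h2 : ∀ e f, ρ e = ρ f → e = f)
    (P : E → Prop) (hP : ∃ e, P e) : ∃ m, IsMaxIn prec P m := by
  classical
  obtain ⟨e, he⟩ := hP
  obtain ⟨m, hm, hmax⟩ := Finset.exists_max_image (Finset.univ.filter P) ρ ⟨e, by simpa using he⟩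
  refine ⟨m, by simpa using hm, fun x hx => ?_⟩
  have := hmax x (by simpa using hx)
  rcases this.lt_or_eq with h | h
  · exact Or.inr ((h1 _ _).mpr h)
  · exact Or.inl (h2 _ _ h)

theorem exists_minIn {E : Type*} [Fintype E] (prec : E → E → Prop) (ρ : E → ℕ)
    (h1 : ∀ e f, prec e f ↔ ρ e < ρ f) (h2 : ∀ e f, ρ e = ρ f → e = f)
    (P : E → Prop) (hP : ∃ e, P e) : ∃ m, IsMinIn prec P m := by
  classical
  obtain ⟨e, he⟩ := hP
  obtain ⟨m, hm, hmax⟩ := Finset.exists_min_image (Finset.univ.filter P) ρ ⟨e, by simpa using he⟩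
  refine ⟨m, by simpa using hm, fun x hx => ?_⟩
  have := hmax x (by simpa using hx)
  rcases this.lt_or_eq with h | h
  · exact Or.inr ((h1 _ _).mpr h)
  · exact Or.inl (h2 _ _ h.symm)

open Relation in
theorem stmt10 {V E : Type*} [Fintype V] [Fintype E] (s t : E → V)
    (prec : E → E → Prop)
    (hproc : Processive s t) (hpo : IsPlanarOrder (EReach s t) prec) :
    IsPlanarOrder (VReach s t) (VPrec s t prec) := by
  obtain ⟨hac, hsrc, hsnk⟩ := hproc
  obtain ⟨hlin, hP1, hP2⟩ := hpo
  obtain ⟨ρ, hρ, hinj, hadj⟩ := exists_rank prec hlin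
  simp only [ereach_iff s t hac] at hP1 hP2
  have hac' : ∀ v, ¬ TransGen (EdgeAdj s t) v v := fun v h => hac v ((vreach_iff s t v v).mpr h)
  have exMax : ∀ v, (∃ e, t e = v) → ∃ m, IsMaxIn prec (fun e => t e = v) m :=
    fun v h => exists_maxIn prec ρ hρ hinj _ h
  have exMin : ∀ v, (∃ e, s e = v) → ∃ m, IsMinIn prec (fun e => s e = v) m :=
    fun v h => exists_minIn prec ρ hρ hinj _ h
  have maxle : ∀ v m, IsMaxIn prec (fun e => t e = v) m → ∀ e, t e = v → ρ e ≤ ρ m := by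
    intro v m hm e he
    rcases hm.2 e he with h | h
    · rw [h]
    · exact ((hρ _ _).mp h).le
  have minle : ∀ v m, IsMinIn prec (fun e => s e = v) m → ∀ e, s e = v → ρ m ≤ ρ e := by
    intro v m hm e he
    rcases hm.2 e he with h | h
    · rw [h]
    · exact ((hρ _ _).mp h).le
  have adj : ∀ v i o, IsMaxIn prec (fun e => t e = v) i → IsMinIn prec (fun e => s e = v) o →
      ρ o = ρ i + 1 := by
    intro v i o hi ho
    have hti : t i = v := hi.1
    have hso : s o = v := ho.1
    have hio : ReflTransGen (EdgeAdj s t) (t i) (s o) := by rw [hti, hso]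
    refine hadj i o (hP1 _ _ hio) ?_
    intro x h1 h2
    have h1' := (hρ _ _).mp h1
    have h2' := (hρ _ _).mp h2
    rcases hP2 _ _ _ h1 h2 hio with h | h
    · rcases ReflTransGen.cases_head h with h | ⟨c, ⟨g, hg, hg'⟩, hr⟩
      · have := minle v o ho x (h.symm.trans hti); omega
      · have a := minle v o ho g (hg.trans hti)
        have b := (hρ _ _).mp (hP1 g x (by rw [hg']; exact hr))
        omega
    · rcases ReflTransGen.cases_tail h with h | ⟨c, hr, ⟨g, hg, hg'⟩⟩
      · have := maxle v i hi x (h.symm.trans hso); omega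
      · have a := maxle v i hi g (hg'.trans hso)
        have b := (hρ _ _).mp (hP1 x g (by rw [hg]; exact hr))
        omega
  have kinds : ∀ v, (∃ i, IsMaxIn prec (fun e => t e = v) i) ∨
      ((∀ e, t e ≠ v) ∧ ∃ o, IsMinIn prec (fun e => s e = v) o) := by
    intro v
    by_cases h : ∃ e, t e = v
    · exact Or.inl (exMax v h)
    · push Not at h
      exact Or.inr ⟨h, exMin v (exists_incident s t v (hsrc v h) h)⟩
  have exK : ∀ v, ∃ k : ℕ, (∀ i, IsMaxIn prec (fun e => t e = v) i → k = 2 * ρ i + 2) ∧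
      (∀ o, IsMinIn prec (fun e => s e = v) o → ((k = 2 * ρ o ∧ ∃ e, t e = v) ∨
        ((∀ e, t e ≠ v) ∧ k = 2 * ρ o + 1))) := by
    intro v
    rcases kinds v with ⟨i, hi⟩ | ⟨hn, o, ho⟩
    · refine ⟨2 * ρ i + 2, fun j hj => ?_, fun o ho => ?_⟩
      · have := maxle v i hi j hj.1
        have := maxle v j hj i hi.1
        omega
      · have := adj v i o hi ho
        exact Or.inl ⟨by omega, i, hi.1⟩
    · refine ⟨2 * ρ o + 1, fun j hj => absurd hj.1 (hn j), fun p hp => ?_⟩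
      right
      refine ⟨hn, ?_⟩
      have := minle v o ho p hp.1
      have := minle v p hp o ho.1
      omega
  choose K hKi hKo using exK
  have hKo' : ∀ v o, IsMinIn prec (fun e => s e = v) o → K v = 2 * ρ o ∨ K v = 2 * ρ o + 1 :=
    fun v o ho => (hKo v o ho).imp And.left And.right
  have kinds' : ∀ v, (∃ i, IsMaxIn prec (fun e => t e = v) i ∧ K v = 2 * ρ i + 2) ∨
      ((∀ e, t e ≠ v) ∧ ∃ o, IsMinIn prec (fun e => s e = v) o ∧ K v = 2 * ρ o + 1 ∧
        ∀ e, s e = v → e = o) := by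
    intro v
    rcases kinds v with ⟨i, hi⟩ | ⟨hn, o, ho⟩
    · exact Or.inl ⟨i, hi, hKi v i hi⟩
    · refine Or.inr ⟨hn, o, ho, ?_, fun e he => degree_source s t v (hsrc v hn) e o he ho.1⟩
      rcases hKo v o ho with h | h
      · obtain ⟨-, e, he⟩ := h
        exact absurd he (hn e)
      · exact h.2
  have Kinj : ∀ v w, K v = K w → v = w := by
    intro v w h
    rcases kinds' v with ⟨i, hi, hk⟩ | ⟨-, o, ho, hk, -⟩ <;>
    rcases kinds' w with ⟨i', hi', hk'⟩ | ⟨-, o', ho', hk', -⟩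
    · have := hinj i i' (by omega)
      subst this
      exact hi.1.symm.trans hi'.1
    · omega
    · omega
    · have := hinj o o' (by omega)
      subst this
      exact ho.1.symm.trans ho'.1
  have hV : ∀ v w, VPrec s t prec v w ↔ K v < K w := by
    intro v w
    constructor
    · rintro ⟨hne, h⟩
      have hk : K v ≠ K w := fun h => hne (Kinj _ _ h)
      rcases h with ⟨i1, i2, h1, h2, h⟩ | ⟨i1, o2, h1, h2, h⟩ | ⟨o1, i2, h1, h2, h⟩ |
        ⟨o1, o2, h1, h2, h⟩
      · rw [hρ] at h
        have := hKi _ _ h1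
        have := hKi _ _ h2
        omega
      · rw [hρ] at h
        have := hKi _ _ h1
        have := hKo' _ _ h2
        omega
      · have h : ρ o1 ≤ ρ i2 := by
          rcases h with h | h
          · rw [h]
          · rw [hρ] at h; omega
        have := hKo' _ _ h1
        have := hKi _ _ h2
        omega
      · rw [hρ] at h
        have := hKo' _ _ h1
        have := hKo' _ _ h2
        omega
    · intro h
      refine ⟨fun hvw => by rw [hvw] at h; omega, ?_⟩
      rcases kinds' v with ⟨i, hi, hk⟩ | ⟨-, o, ho, hk, -⟩ <;>
      rcases kinds' w with ⟨i', hi', hk'⟩ | ⟨-, o', ho', hk', -⟩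
      · exact Or.inl ⟨i, i', hi, hi', (hρ _ _).mpr (by omega)⟩
      · exact Or.inr (Or.inl ⟨i, o', hi, ho', (hρ _ _).mpr (by omega)⟩)
      · refine Or.inr (Or.inr (Or.inl ⟨o, i', ho, hi', ?_⟩))
        rcases (show ρ o ≤ ρ i' by omega).lt_or_eq with h | h
        · exact Or.inr ((hρ _ _).mpr h)
        · exact Or.inl (hinj _ _ h)
      · exact Or.inr (Or.inr (Or.inr ⟨o, o', ho, ho', (hρ _ _).mpr (by omega)⟩))
  -- edges increase the key
  have Kedge : ∀ v w, EdgeAdj s t v w → K v < K w := by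
    rintro v w ⟨e, he, he'⟩
    obtain ⟨o, ho⟩ := exMin v ⟨e, he⟩
    obtain ⟨i, hi⟩ := exMax w ⟨e, he'⟩
    have := minle v o ho e he
    have := maxle w i hi e he'
    have := hKo' v o ho
    have := hKi w i hi
    omega
  have Kpath : ∀ v w, TransGen (EdgeAdj s t) v w → K v < K w := by
    intro v w h
    induction h with
    | single h => exact Kedge _ _ h
    | tail _ h ih => exact ih.trans (Kedge _ _ h)
  -- reaching an edge incident to `v`, or being reached by it
  have into : ∀ a b x v, EdgeAdj s t a b → (s x = v ∨ t x = v) →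
      ReflTransGen (EdgeAdj s t) b (s x) → TransGen (EdgeAdj s t) a v := by
    rintro a b x v hab (h | h) hr
    · subst h; exact TransGen.head' hab hr
    · exact TransGen.head' hab (hr.tail ⟨x, rfl, h⟩)
  have into' : ∀ a x v, a ≠ v → (s x = v ∨ t x = v) →
      ReflTransGen (EdgeAdj s t) a (s x) → TransGen (EdgeAdj s t) a v := by
    rintro a x v hne (h | h) hr
    · subst h
      rcases reflTransGen_iff_eq_or_transGen.mp hr with h | h
      · exact absurd h.symm hne
      · exact h
    · exact TransGen.tail' hr ⟨x, rfl, h⟩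
  have outof : ∀ x v c, v ≠ c → (s x = v ∨ t x = v) →
      ReflTransGen (EdgeAdj s t) (t x) c → TransGen (EdgeAdj s t) v c := by
    rintro x v c hne (h | h) hr
    · exact TransGen.head' ⟨x, h, rfl⟩ hr
    · subst h
      rcases reflTransGen_iff_eq_or_transGen.mp hr with h | h
      · exact absurd h.symm hne
      · exact h
  have single : ∀ v1 v2 v3, EdgeAdj s t v1 v3 → K v1 < K v2 → K v2 < K v3 →
      TransGen (EdgeAdj s t) v1 v2 ∨ TransGen (EdgeAdj s t) v2 v3 := by
    intro v1 v2 v3 hE h12 h23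
    have hne12 : v1 ≠ v2 := fun h => by rw [h] at h12; omega
    have hne23 : v2 ≠ v3 := fun h => by rw [h] at h23; omega
    obtain ⟨e, he, he'⟩ := id hE
    -- case: the incident edge lies after `e`
    have caseA : ∀ x, (s x = v2 ∨ t x = v2) → ρ e < ρ x →
        (∀ i3, IsMaxIn prec (fun e => t e = v3) i3 → ρ x ≤ ρ i3) →
        TransGen (EdgeAdj s t) v1 v2 ∨ TransGen (EdgeAdj s t) v2 v3 := by
      intro x hx hex hxi
      obtain ⟨i3, hi3⟩ := exMax v3 ⟨e, he'⟩
      have hle := hxi i3 hi3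
      have hout : ∃ f, s f = v3 := by
        by_contra! hno
        have := degree_sink s t v3 (hsnk v3 hno) e i3 he' hi3.1
        rw [← this] at hle; omega
      obtain ⟨o3, ho3⟩ := exMin v3 hout
      have hso : s o3 = v3 := ho3.1
      have := adj v3 i3 o3 hi3 ho3
      rcases hP2 e x o3 ((hρ _ _).mpr hex) ((hρ _ _).mpr (by omega))
        (by rw [he', hso]) with h | h
      · left; exact into v1 v3 x v2 hE hx (by rwa [he'] at h)
      · right; exact outof x v2 v3 hne23 hx (by rwa [hso] at h)
    have caseB : ∀ x, (s x = v2 ∨ t x = v2) → ρ x < ρ e → K v2 ≤ 2 * ρ x + 2 →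
        (∀ i1, IsMaxIn prec (fun e => t e = v1) i1 → ρ i1 < ρ x) →
        TransGen (EdgeAdj s t) v1 v2 ∨ TransGen (EdgeAdj s t) v2 v3 := by
      intro x hx hex hK hxi
      rcases kinds' v1 with ⟨i1, hi1, -⟩ | ⟨-, o, ho, hk, hu⟩
      · have hti : t i1 = v1 := hi1.1
        rcases hP2 i1 x e ((hρ _ _).mpr (hxi i1 hi1)) ((hρ _ _).mpr hex)
          (by rw [he, hti]) with h | h
        · left; exact into' v1 x v2 hne12 hx (by rwa [hti] at h)
        · right; exact (outof x v2 v1 hne12.symm hx (by rwa [he] at h)).tail hE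
      · have := hu e he
        subst this
        omega
    rcases kinds' v2 with ⟨i, hi, hk⟩ | ⟨-, o, ho, hk, -⟩
    · have hti : t i = v2 := hi.1
      rcases lt_trichotomy (ρ e) (ρ i) with h | h | h
      · exact caseA i (Or.inr hti) h (fun i3 hi3 => by have := hKi v3 i3 hi3; omega)
      · have := hinj _ _ h
        subst this
        exact absurd (hti.symm.trans he') hne23
      · exact caseB i (Or.inr hti) h (by omega)
          (fun i1 hi1 => by have := hKi v1 i1 hi1; omega)
    · have hso : s o = v2 := ho.1
      rcases lt_trichotomy (ρ e) (ρ o) with h | h | h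
      · exact caseA o (Or.inl hso) h (fun i3 hi3 => by have := hKi v3 i3 hi3; omega)
      · have := hinj _ _ h
        subst this
        exact absurd (he.symm.trans hso) hne12
      · exact caseB o (Or.inl hso) h (by omega)
          (fun i1 hi1 => by have := hKi v1 i1 hi1; omega)
  have main : ∀ v1 v3, TransGen (EdgeAdj s t) v1 v3 → ∀ v2, K v1 < K v2 → K v2 < K v3 →
      TransGen (EdgeAdj s t) v1 v2 ∨ TransGen (EdgeAdj s t) v2 v3 := by
    intro v1 v3 h
    induction h with
    | single h => exact fun v2 => single _ v2 _ h
    | @tail u w hu hw ih =>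
      intro v2 h12 h23
      rcases lt_trichotomy (K v2) (K u) with h | h | h
      · rcases ih v2 h12 h with h | h
        · exact Or.inl h
        · exact Or.inr (h.tail hw)
      · rw [Kinj _ _ h]; exact Or.inl hu
      · rcases single u v2 w hw h h23 with h | h
        · exact Or.inl (hu.trans h)
        · exact Or.inr h
  refine ⟨⟨?_, ?_, ?_⟩, ?_, ?_⟩
  · intro x hx; exact hx.1 rfl
  · intro x y z; simp only [hV]; exact lt_trans
  · intro x y hne; simp only [hV]
    exact lt_or_gt_of_ne (fun h => hne (Kinj _ _ h))
  · intro x y; rw [vreach_iff, hV]; exact Kpath x y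
  · intro x y z; simp only [hV, vreach_iff]
    exact fun h1 h2 h3 => main x z h3 y h1 h2
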